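/- After removing the directed edge a⋆ → b, for every c ∈ de(b) with c ≠ b one has Σ⋆ b c = Σ b c − λ Σ a⋆ c − λ Σ a⋆ b · (P b c) + λ² Σ a⋆ a⋆ · (P b c), where P b c = ((1 − Λ)⁻¹) b c is the sum of the weights of all directed paths from b to c. -/

import Mathlib

open Matrix

attribute [local instance] Classical.propDecidable

namespace EdgeIntervention

variable {n : ℕ}

/-- Descendants of `b` (including `b`): vertices reachable under the edge relation of `D`. -/
def desc (D : Set (Fin n × Fin n)) (b : Fin n) : Set (Fin n) :=
  {c | Relation.ReflTransGen (fun i j => (i, j) ∈ D) b c}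

/-- Ancestors of `c` (including `c`). -/
def anc (D : Set (Fin n × Fin n)) (c : Fin n) : Set (Fin n) :=
  {i | c ∈ desc D i}

/-- Descendants of `b` in the induced subgraph on `W`. -/
def descW (D : Set (Fin n × Fin n)) (W : Set (Fin n)) (b : Fin n) : Set (Fin n) :=
  {c | Relation.ReflTransGen (fun i j => (i, j) ∈ D ∧ i ∈ W ∧ j ∈ W) b c}

/-- District of `b` in the induced subgraph on `W`. -/
def disW (B : Set (Fin n × Fin n)) (W : Set (Fin n)) (b : Fin n) : Set (Fin n) :=
  {c | Relation.ReflTransGen (fun i j => (i, j) ∈ B ∧ i ∈ W ∧ j ∈ W) b c}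

/-- Markov blanket of `b` in the induced subgraph on `W`. -/
def mbW (D B : Set (Fin n × Fin n)) (W : Set (Fin n)) (b : Fin n) : Set (Fin n) :=
  (disW B W b ∪ {i | i ∈ W ∧ ∃ d ∈ disW B W b, (i, d) ∈ D}) \ {b}

/-- `Λ` is supported on the directed edge set `D`. -/
def DSupported (D : Set (Fin n × Fin n)) (Λ : Matrix (Fin n) (Fin n) ℝ) : Prop :=
  ∀ i j, (i, j) ∉ D → Λ i j = 0

/-- `Ω` is compatible with the bidirected edge set `B`: symmetric, positive definite,
and vanishing off the diagonal and off `B`. -/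
def BCompatible (B : Set (Fin n × Fin n)) (Ω : Matrix (Fin n) (Fin n) ℝ) : Prop :=
  Ω.IsSymm ∧ Ω.PosDef ∧ ∀ i j, i ≠ j → (i, j) ∉ B → Ω i j = 0

/-- The covariance matrix `Σ = ((1 - Λ)⁻¹)ᵀ * Ω * (1 - Λ)⁻¹` of the linear SEM. -/
noncomputable def cov (Λ Ω : Matrix (Fin n) (Fin n) ℝ) : Matrix (Fin n) (Fin n) ℝ :=
  ((1 - Λ)⁻¹)ᵀ * Ω * (1 - Λ)⁻¹

/-- Sum over all directed paths from `i` to `j` of their weights.  A path with `k` edges is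
encoded as `f : Fin (k+1) → Fin n` with all steps in `D`; since edges strictly increase,
every directed path has at most `n` edges, so `k` ranges over `Finset.range (n+1)`. -/
noncomputable def pathSum (D : Set (Fin n × Fin n)) (Λ : Matrix (Fin n) (Fin n) ℝ)
    (i j : Fin n) : ℝ :=
  ∑ k ∈ Finset.range (n + 1),
    ∑ f ∈ Finset.univ.filter
        (fun f : Fin (k + 1) → Fin n =>
          f 0 = i ∧ f (Fin.last k) = j ∧ ∀ t : Fin k, (f t.castSucc, f t.succ) ∈ D),
      ∏ t : Fin k, Λ (f t.castSucc) (f t.succ)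

/-- Conditional covariance `σ_{vw·S} = Σ v w − Σ_{vS} (Σ_{SS})⁻¹ Σ_{Sw}`. -/
noncomputable def condCov (Cov : Matrix (Fin n) (Fin n) ℝ) (S : Set (Fin n))
    (v w : Fin n) : ℝ :=
  letI := (Set.toFinite S).fintype
  Cov v w - ∑ i : S, ∑ j : S,
    Cov v i.val * (Cov.submatrix (Subtype.val : S → Fin n) Subtype.val)⁻¹ i j * Cov j.val w

/-- Regression coefficient `β_{vw·S} = σ_{vw·S} / σ_{vv·S}`. -/
noncomputable def regCoef (Cov : Matrix (Fin n) (Fin n) ℝ) (S : Set (Fin n))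
    (v w : Fin n) : ℝ :=
  condCov Cov S v w / condCov Cov S v v

/-- The matrix obtained from `Λ` by setting the `(a,b)` entry to `0`
(removal of the directed edge `a → b`). -/
def removeEdge (Λ : Matrix (Fin n) (Fin n) ℝ) (a b : Fin n) : Matrix (Fin n) (Fin n) ℝ :=
  Matrix.of fun i j => if i = a ∧ j = b then 0 else Λ i j

/-- The matrix obtained from `Ω` by setting the `(a,b)` and `(b,a)` entries to `0`
(removal of the bidirected edge `a ↔ b`). -/
def removeBi (Ω : Matrix (Fin n) (Fin n) ℝ) (a b : Fin n) : Matrix (Fin n) (Fin n) ℝ :=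
  Matrix.of fun i j => if (i = a ∧ j = b) ∨ (i = b ∧ j = a) then 0 else Ω i j

section

variable {D : Set (Fin n × Fin n)} {Λ : Matrix (Fin n) (Fin n) ℝ}

theorem DSupported.apply_eq_zero_of_le (hΛ : DSupported D Λ)
    (hD : ∀ i j : Fin n, (i, j) ∈ D → i < j) {i j : Fin n} (hij : j ≤ i) : Λ i j = 0 :=
  hΛ i j fun h => (hD i j h).not_ge hij

theorem DSupported.blockTriangular_one_sub (hΛ : DSupported D Λ)
    (hD : ∀ i j : Fin n, (i, j) ∈ D → i < j) : (1 - Λ).BlockTriangular id :=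
  blockTriangular_one.sub fun _ _ hij => hΛ.apply_eq_zero_of_le hD hij.le

theorem DSupported.isUnit_det_one_sub (hΛ : DSupported D Λ)
    (hD : ∀ i j : Fin n, (i, j) ∈ D → i < j) : IsUnit (1 - Λ).det := by
  rw [det_of_isUpperTriangular (hΛ.blockTriangular_one_sub hD)]
  simp [hΛ.apply_eq_zero_of_le hD le_rfl]

theorem DSupported.inv_one_sub_apply_eq_zero (hΛ : DSupported D Λ)
    (hD : ∀ i j : Fin n, (i, j) ∈ D → i < j) {i j : Fin n} (hij : j < i) :
    (1 - Λ)⁻¹ i j = 0 := by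
  have : Invertible (1 - Λ) := invertibleOfIsUnitDet _ (hΛ.isUnit_det_one_sub hD)
  exact blockTriangular_inv_of_blockTriangular (hΛ.blockTriangular_one_sub hD) hij

theorem DSupported.inv_one_sub_apply_self (hΛ : DSupported D Λ)
    (hD : ∀ i j : Fin n, (i, j) ∈ D → i < j) (i : Fin n) : (1 - Λ)⁻¹ i i = 1 := by
  have h := congrFun₂ (nonsing_inv_mul (1 - Λ) (hΛ.isUnit_det_one_sub hD)) i i
  rw [mul_sub, mul_one, Matrix.sub_apply, mul_apply, one_apply_eq, Finset.sum_eq_zero, sub_zero] at h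
  · exact h
  · intro j _
    rcases lt_or_ge j i with hj | hj
    · rw [hΛ.inv_one_sub_apply_eq_zero hD hj, zero_mul]
    · rw [hΛ.apply_eq_zero_of_le hD hj, mul_zero]

theorem one_sub_removeEdge (Λ : Matrix (Fin n) (Fin n) ℝ) (a b : Fin n) :
    1 - removeEdge Λ a b = (1 - Λ) + single a b (Λ a b) := by
  ext i j
  by_cases h : i = a ∧ j = b
  · obtain ⟨rfl, rfl⟩ := h
    simp [removeEdge]
  · have h' : ¬(a = i ∧ b = j) := fun h' => h ⟨h'.1.symm, h'.2.symm⟩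
    simp [removeEdge, single_apply_of_ne _ _ _ _ _ h', h]

/-- The rank-one update of the path matrix `(1 - Λ)⁻¹` under removal of the edge `a → b`. -/
theorem DSupported.inv_one_sub_removeEdge (hΛ : DSupported D Λ)
    (hD : ∀ i j : Fin n, (i, j) ∈ D → i < j) {a b : Fin n} (hab : a < b) :
    (1 - removeEdge Λ a b)⁻¹ =
      (1 - Λ)⁻¹ - (1 - Λ)⁻¹ * single a b (Λ a b) * (1 - Λ)⁻¹ := by
  apply inv_eq_right_inv
  rw [one_sub_removeEdge]
  have hP := mul_nonsing_inv (1 - Λ) (hΛ.isUnit_det_one_sub hD)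
  have hz : single a b (Λ a b) * (1 - Λ)⁻¹ * single a b (Λ a b) = 0 := by
    rw [single_mul_mul_single, hΛ.inv_one_sub_apply_eq_zero hD hab]
    simp
  generalize (1 - Λ)⁻¹ = P at hP hz ⊢
  generalize single a b (Λ a b) = E at hz ⊢
  calc ((1 - Λ) + E) * (P - P * E * P)
      = (1 - Λ) * P + E * P - (1 - Λ) * P * (E * P) - E * P * E * P := by noncomm_ring
    _ = 1 := by rw [hP, hz]; noncomm_ring

theorem DSupported.inv_one_sub_removeEdge_apply (hΛ : DSupported D Λ)
    (hD : ∀ i j : Fin n, (i, j) ∈ D → i < j) {a b : Fin n} (hab : a < b) (i c : Fin n) :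
    (1 - removeEdge Λ a b)⁻¹ i c =
      (1 - Λ)⁻¹ i c - Λ a b * (1 - Λ)⁻¹ b c * (1 - Λ)⁻¹ i a := by
  rw [hΛ.inv_one_sub_removeEdge hD hab, Matrix.sub_apply, mul_apply, Finset.sum_eq_single b]
  · rw [mul_single_apply_same]
    ring
  · intro j _ hj
    rw [mul_single_apply_of_ne _ _ _ _ _ hj, zero_mul]
  · simp

end

theorem cov_apply (Λ Ω : Matrix (Fin n) (Fin n) ℝ) (i j : Fin n) :
    cov Λ Ω i j = ((1 - Λ)⁻¹).col i ⬝ᵥ Ω *ᵥ ((1 - Λ)⁻¹).col j := by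
  rw [cov, Matrix.mul_assoc]
  rfl

theorem cov_comm (Λ : Matrix (Fin n) (Fin n) ℝ) {Ω : Matrix (Fin n) (Fin n) ℝ} (hΩ : Ω.IsSymm)
    (i j : Fin n) : cov Λ Ω i j = cov Λ Ω j i := by
  rw [cov_apply, cov_apply, dotProduct_comm, dotProduct_mulVec, ← mulVec_transpose, hΩ.eq]

/-- after removing the directed edge `a⋆ → b`, for every `c ∈ de(b)`, `c ≠ b`,
`Σ⋆ b c = Σ b c − λ Σ a⋆ c − λ Σ a⋆ b (P b c) + λ² Σ a⋆ a⋆ (P b c)` with `P = (1 − Λ)⁻¹`. -/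
theorem remove_edge_cov_b_c (n : ℕ) (D B : Set (Fin n × Fin n))
    (hD : ∀ i j : Fin n, (i, j) ∈ D → i < j)
    (hBsymm : ∀ i j : Fin n, (i, j) ∈ B → (j, i) ∈ B)
    (hBirr : ∀ i : Fin n, (i, i) ∉ B)
    (Λ Ω : Matrix (Fin n) (Fin n) ℝ)
    (hΛ : DSupported D Λ) (hΩ : BCompatible B Ω)
    (astar b : Fin n) (hab : (astar, b) ∈ D) :
    ∀ c : Fin n, c ∈ desc D b → c ≠ b →
      cov (removeEdge Λ astar b) Ω b c
        = cov Λ Ω b c - Λ astar b * cov Λ Ω astar c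
          - Λ astar b * cov Λ Ω astar b * (1 - Λ)⁻¹ b c
          + (Λ astar b) ^ 2 * cov Λ Ω astar astar * (1 - Λ)⁻¹ b c := by
  intro c _ _
  have hcol : ∀ d, ((1 - removeEdge Λ astar b)⁻¹).col d = ((1 - Λ)⁻¹).col d -
      (Λ astar b * (1 - Λ)⁻¹ b d) • ((1 - Λ)⁻¹).col astar := fun d =>
    funext fun i => hΛ.inv_one_sub_removeEdge_apply hD (hD _ _ hab) i d
  rw [cov_comm Λ hΩ.1 astar b]
  simp only [cov_apply, hcol, hΛ.inv_one_sub_apply_self hD b, mulVec_sub, mulVec_smul,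
    dotProduct_sub, sub_dotProduct, dotProduct_smul, smul_dotProduct, smul_eq_mul]
  ring

end EdgeIntervention
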